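/- Fix p ≥ 1 and q ≥ 0. For a subset S ⊆ {1,…,p−1} and x, y ∈ UT2 define u_k(S) = y and v_k(S) = x if k ∈ S, and u_k(S) = x and v_k(S) = y otherwise. For 0 ≤ i ≤ q define the functions UT2^3 → M2(F): h^{(i)}(x,y,z) = Σ_{S ⊆ {1,…,p−1}} (−1)^{|S|} · Σ_{τ ∈ S_3} sgn(τ) · x^{i} · u_1(S)⋯u_{p−1}(S) · t_{τ(1)} t_{τ(2)} t_{τ(3)} · v_1(S)⋯v_{p−1}(S) · x^{q−i}, where (t_1, t_2, t_3) = (x, y, z). Then these q+1 functions are linearly independent over F in the space of all functions UT2^3 → M2(F). (This is the key step showing that the multiplicity of χ_{(p+q,p,1)} in the generalized cocharacter of UT2 is at least q+1; by Theorem 4.4 it equals q+1.) -/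

import Mathlib

/-- The `F`-subspace of `2×2` upper triangular matrices inside the full matrix algebra. -/
def UTsub (F : Type*) [Field F] : Submodule F (Matrix (Fin 2) (Fin 2) F) where
  carrier := {m | m 1 0 = 0}
  add_mem' := by
    intro a b ha hb
    simp only [Set.mem_setOf_eq, Matrix.add_apply] at *
    rw [ha, hb, add_zero]
  zero_mem' := rfl
  smul_mem' := by
    intro c a ha
    simp only [Set.mem_setOf_eq, Matrix.smul_apply] at *
    rw [ha, smul_zero]

/-- The algebra `UT₂` of `2×2` upper triangular matrices, as a type. -/
abbrev UT (F : Type*) [Field F] := ↥(UTsub F)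

/-- `uprod m x y S = u₁(S)⋯u_m(S)` where `u_k(S) = y` if `k ∈ S` and `u_k(S) = x` otherwise. -/
def uprod {F : Type*} [Field F] (m : ℕ) (x y : Matrix (Fin 2) (Fin 2) F)
    (S : Finset (Fin m)) : Matrix (Fin 2) (Fin 2) F :=
  (List.ofFn fun k : Fin m => if k ∈ S then y else x).prod

/-- The `q+1` functions `h⁽ⁱ⁾ : UT₂³ → M₂(F)`, `0 ≤ i ≤ q`, attached to the partition
`(p+q, p, 1)`:
`h⁽ⁱ⁾(x,y,z) = Σ_{S ⊆ {1,…,p−1}} (−1)^{|S|} Σ_{τ ∈ S₃} sgn(τ) ·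
xⁱ · u₁(S)⋯u_{p−1}(S) · t_{τ(1)} t_{τ(2)} t_{τ(3)} · v₁(S)⋯v_{p−1}(S) · x^{q−i}`,
where `(t₁,t₂,t₃) = (x,y,z)`, `u_k(S) = y, v_k(S) = x` for `k ∈ S` and `u_k(S) = x,
v_k(S) = y` otherwise. -/
def threeRowFamily (F : Type*) [Field F] (p q : ℕ) (i : Fin (q + 1))
    (xyz : UT F × UT F × UT F) : Matrix (Fin 2) (Fin 2) F :=
  let x : Matrix (Fin 2) (Fin 2) F := ↑xyz.1
  let y : Matrix (Fin 2) (Fin 2) F := ↑xyz.2.1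
  let z : Matrix (Fin 2) (Fin 2) F := ↑xyz.2.2
  let t : Fin 3 → Matrix (Fin 2) (Fin 2) F := ![x, y, z]
  ∑ S : Finset (Fin (p - 1)), ∑ τ : Equiv.Perm (Fin 3),
    ((-1 : F) ^ S.card * ((Equiv.Perm.sign τ : ℤ) : F)) •
      (x ^ (i : ℕ) * uprod (p - 1) x y S * (t (τ 0) * t (τ 1) * t (τ 2)) *
        uprod (p - 1) y x S * x ^ (q - (i : ℕ)))

open Matrix in
lemma uprod_diagonal {F : Type*} [Field F] (m : ℕ) (v w : Fin 2 → F) (S : Finset (Fin m)) :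
    uprod m (diagonal v) (diagonal w) S =
      diagonal fun j => ∏ k : Fin m, if k ∈ S then w j else v j := by
  have h : (fun k : Fin m => if k ∈ S then diagonal w else diagonal v) =
      (diagonalRingHom (Fin 2) F : (Fin 2 → F) →* Matrix (Fin 2) (Fin 2) F) ∘
        fun k : Fin m => if k ∈ S then w else v := by
    funext k
    by_cases hk : k ∈ S <;> simp [hk]
  rw [uprod, h, ← List.map_ofFn, ← map_list_prod, List.prod_ofFn]
  change diagonal _ = diagonal _
  congr 1
  funext j
  rw [Finset.prod_apply]
  exact Finset.prod_congr rfl fun k _ => by split_ifs <;> rfl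

lemma sum_perm_fin_three {M : Type*} [AddCommMonoid M] (f : Equiv.Perm (Fin 3) → M) :
    ∑ τ, f τ = f 1 + f (Equiv.swap 0 1) + f (Equiv.swap 0 2) + f (Equiv.swap 1 2) +
      f (Equiv.swap 0 1 * Equiv.swap 1 2) + f (Equiv.swap 1 2 * Equiv.swap 0 1) := by
  have h : (Finset.univ : Finset (Equiv.Perm (Fin 3))) =
      {1, Equiv.swap 0 1, Equiv.swap 0 2, Equiv.swap 1 2,
        Equiv.swap 0 1 * Equiv.swap 1 2, Equiv.swap 1 2 * Equiv.swap 0 1} := by decide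
  rw [h, Finset.sum_insert (by decide), Finset.sum_insert (by decide),
    Finset.sum_insert (by decide), Finset.sum_insert (by decide),
    Finset.sum_insert (by decide), Finset.sum_singleton]
  simp only [add_assoc]

/-- The point `(diag(a, 1), e₂₂, e₁₂)` of `UT₂³`. -/
def testPoint {F : Type*} [Field F] (a : F) : UT F × UT F × UT F :=
  (⟨Matrix.diagonal ![a, 1], by change _ = _; simp⟩, ⟨Matrix.diagonal ![0, 1], by change _ = _; simp⟩,
    ⟨!![0, 1; 0, 0], rfl⟩)

lemma threeRowFamily_testPoint {F : Type*} [Field F] (p q : ℕ) (hp : 1 ≤ p) (i : Fin (q + 1))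
    (a : F) : threeRowFamily F p q i (testPoint a) 0 1 = -a ^ (p + (i : ℕ)) := by
  obtain ⟨m, rfl⟩ : ∃ m, p = m + 1 := ⟨p - 1, by omega⟩
  simp only [threeRowFamily, testPoint, uprod_diagonal, Matrix.diagonal_pow,
    Matrix.sum_apply]
  rw [Finset.sum_eq_single ∅]
  · rw [sum_perm_fin_three]
    simp [Matrix.mul_apply, Fin.sum_univ_two, Equiv.swap_apply_def, Matrix.vecMul_diagonal]
    ring
  · intro S _ hS
    obtain ⟨k, hk⟩ := Finset.nonempty_iff_ne_empty.mpr hS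
    have h0 : (∏ k : Fin m, if k ∈ S then (0 : F) else a) = 0 :=
      Finset.prod_eq_zero (Finset.mem_univ k) (by simp [hk])
    refine Finset.sum_eq_zero fun τ _ => ?_
    simp [mul_assoc, h0]
  · simp

/-- Fix `p ≥ 1`, `q ≥ 0`. The `q+1` functions `h⁽ⁱ⁾`, `0 ≤ i ≤ q`, are linearly
independent over `F`; hence `m_{(p+q,p,1)} ≥ q+1` in the generalized cocharacter of
`UT₂`. -/
theorem three_row_multiplicity_lower_bound (F : Type*) [Field F] [CharZero F]
    (p q : ℕ) (hp : 1 ≤ p) :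
    LinearIndependent F (threeRowFamily F p q) := by
  rw [Fintype.linearIndependent_iff]
  intro g hg i
  have hP : (∑ j : Fin (q + 1), Polynomial.monomial (p + (j : ℕ)) (g j)) = 0 := by
    refine Polynomial.funext fun a => ?_
    have h := congrFun (congrFun (congrFun hg (testPoint a)) 0) 1
    simpa [Finset.sum_apply, Matrix.sum_apply, threeRowFamily_testPoint p q hp,
      Polynomial.eval_finsetSum] using h
  have h := congrArg (Polynomial.coeff · (p + (i : ℕ))) hP
  simpa [Polynomial.finsetSum_coeff, Polynomial.coeff_monomial, Fin.val_inj] using h
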